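/- arXiv:2506.04003 — 2 statements merged into one kernel-verified Lean document; each statement's English description precedes it below -/
import Mathlib

section
/- Let (X,d,μ) and (X',d',μ') be metric measure spaces with X, X' compact, p ≥ 1, δ a metric coupling, and h a probabilistic coupling of μ and μ'. If (f,f') and (g,g') are pairs of metric observables such that f ⊔ f' and g ⊔ g' (defined on K ⊔ K' where K = supp μ, K' = supp μ') are 1-Lipschitz with respect to δ, then |(∫_X |f−g|^p dμ)^{1/p} − (∫_{X'} |f'−g'|^p dμ')^{1/p}| ≤ 2 (∫_{X×X'} δ^p(x,y) dh(x,y))^{1/p}. -/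
open MeasureTheory Metric

/-- The support of a measure: points all of whose neighborhoods have positive measure. -/
def msupport {X : Type*} [TopologicalSpace X] [MeasurableSpace X] (μ : Measure X) : Set X :=
  {x : X | ∀ U ∈ nhds x, 0 < μ U}

/-- `δ` is a metric coupling of `(X,d,μ)` and `(X',d',μ')`. -/
def MetricCoupling {X X' : Type*} [MetricSpace X] [MetricSpace X']
    [MeasurableSpace X] [MeasurableSpace X']
    (μ : Measure X) (μ' : Measure X') (δ : X ⊕ X' → X ⊕ X' → ℝ) : Prop :=
  (∀ z, δ z z = 0) ∧ (∀ z w, δ z w = δ w z) ∧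
  (∀ z w u, δ z u ≤ δ z w + δ w u) ∧ (∀ z w, δ z w = 0 → z = w) ∧
  (∀ x ∈ msupport μ, ∀ y ∈ msupport μ, δ (Sum.inl x) (Sum.inl y) = dist x y) ∧
  (∀ x ∈ msupport μ', ∀ y ∈ msupport μ', δ (Sum.inr x) (Sum.inr y) = dist x y)

/-- The function `f ⊔ f'` on `K ⊔ K'` is 1-Lipschitz with respect to `δ`. -/
def SqcupLipschitz {X X' : Type*} (K : Set X) (K' : Set X')
    (δ : X ⊕ X' → X ⊕ X' → ℝ) (f : X → ℝ) (f' : X' → ℝ) : Prop :=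
  ∀ z ∈ Sum.inl '' K ∪ Sum.inr '' K', ∀ w ∈ Sum.inl '' K ∪ Sum.inr '' K',
    |Sum.elim f f' z - Sum.elim f f' w| ≤ δ z w

theorem msupport_eq_support {X : Type*} [TopologicalSpace X] [MeasurableSpace X]
    (μ : Measure X) : msupport μ = μ.support := by
  ext x
  exact (Measure.mem_support_iff_forall x).symm

theorem MetricCoupling.nonneg {X X' : Type*} [MetricSpace X] [MetricSpace X']
    [MeasurableSpace X] [MeasurableSpace X'] {μ : Measure X} {μ' : Measure X'}
    {δ : X ⊕ X' → X ⊕ X' → ℝ} (hδ : MetricCoupling μ μ' δ) (z w : X ⊕ X') : 0 ≤ δ z w := by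
  obtain ⟨hself, hsymm, htri, -⟩ := hδ
  linarith [hself z, hsymm z w, htri z w z]

theorem MetricCoupling.continuousOn {X X' : Type*} [MetricSpace X] [MetricSpace X']
    [MeasurableSpace X] [MeasurableSpace X'] {μ : Measure X} {μ' : Measure X'}
    {δ : X ⊕ X' → X ⊕ X' → ℝ} (hδ : MetricCoupling μ μ' δ) :
    ContinuousOn (fun q : X × X' ↦ δ (Sum.inl q.1) (Sum.inr q.2))
      (msupport μ ×ˢ msupport μ') := by
  obtain ⟨-, hsymm, htri, -, hdist, hdist'⟩ := hδ
  refine (LipschitzOnWith.of_le_add_mul 2 fun a ha b hb ↦ ?_).continuousOn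
  have h₁ := htri (.inl a.1) (.inl b.1) (.inr a.2)
  have h₂ := htri (.inl b.1) (.inr b.2) (.inr a.2)
  rw [hdist _ ha.1 _ hb.1] at h₁
  rw [hdist' _ hb.2 _ ha.2, dist_comm] at h₂
  have h₃ : dist a.1 b.1 ≤ dist a b := le_max_left _ _
  have h₄ : dist a.2 b.2 ≤ dist a b := le_max_right _ _
  norm_num
  linarith

/-- A probabilistic coupling is concentrated on the product of the supports of its marginals. -/
theorem ae_mem_msupport_prod {X X' : Type*} [TopologicalSpace X] [HereditarilyLindelofSpace X]
    [MeasurableSpace X] [TopologicalSpace X'] [HereditarilyLindelofSpace X'] [MeasurableSpace X']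
    (h : Measure (X × X')) :
    ∀ᵐ q ∂h, q ∈ msupport (h.map Prod.fst) ×ˢ msupport (h.map Prod.snd) := by
  simp only [msupport_eq_support]
  filter_upwards [ae_of_ae_map measurable_fst.aemeasurable Measure.support_mem_ae,
    ae_of_ae_map measurable_snd.aemeasurable Measure.support_mem_ae] with q hq hq'
  exact ⟨hq, hq'⟩

theorem MetricCoupling.memLp {X X' : Type*} [MetricSpace X] [CompactSpace X]
    [MeasurableSpace X] [BorelSpace X] [MetricSpace X'] [CompactSpace X'] [MeasurableSpace X']
    [BorelSpace X'] {h : Measure (X × X')} [IsFiniteMeasure h] {δ : X ⊕ X' → X ⊕ X' → ℝ}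
    (hδ : MetricCoupling (h.map Prod.fst) (h.map Prod.snd) δ) (r : ENNReal) :
    MemLp (fun q : X × X' ↦ δ (Sum.inl q.1) (Sum.inr q.2)) r h := by
  have hclosed : IsClosed (msupport (h.map Prod.fst) ×ˢ msupport (h.map Prod.snd)) := by
    simp only [msupport_eq_support]
    exact Measure.isClosed_support.prod Measure.isClosed_support
  have hae := ae_mem_msupport_prod h
  obtain ⟨C, hC⟩ := hclosed.isCompact.exists_bound_of_continuousOn hδ.continuousOn
  have hmeas := hδ.continuousOn.aestronglyMeasurable (μ := h) hclosed.measurableSet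
  rw [Measure.restrict_eq_self_of_ae_mem hae] at hmeas
  exact .of_bound hmeas C (hae.mono hC)

theorem abs_lpNorm_sub_lpNorm_le_two_mul {α : Type*} [MeasurableSpace α] {ν : Measure α}
    {u v w : α → ℝ} {r : ENNReal} (hr : 1 ≤ r) (hu : MemLp u r ν) (hv : MemLp v r ν)
    (hw : MemLp w r ν) (huvw : ∀ᵐ x ∂ν, |u x - v x| ≤ 2 * w x) :
    |lpNorm u r ν - lpNorm v r ν| ≤ 2 * lpNorm w r ν := by
  have hle : lpNorm (u - v) r ν ≤ 2 * lpNorm w r ν := by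
    have := ENNReal.toReal_mono (hw.const_mul 2).eLpNorm_ne_top
      (eLpNorm_mono_ae_real (p := r) (f := u - v) huvw)
    rw [toReal_eLpNorm (hu.sub hv).1, toReal_eLpNorm (hw.const_mul 2).1] at this
    refine this.trans_eq ?_
    simpa using lpNorm_fun_natCast_mul 2 w r ν
  have h₁ := lpNorm_le_lpNorm_add_lpNorm_sub' (f := u) hv hr
  have h₂ := lpNorm_le_lpNorm_add_lpNorm_sub (f := v) hu hr
  rw [abs_sub_le_iff]
  constructor <;> linarith

/-- If `(f,f')` and `(g,g')` are pairs of metric observables whose joins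
`f ⊔ f'` and `g ⊔ g'` are 1-Lipschitz for a metric coupling `δ`, then for any
probabilistic coupling `h` of `μ` and `μ'`,
`|‖f-g‖_{p,μ} - ‖f'-g'‖_{p,μ'}| ≤ 2 (∫ δ^p dh)^{1/p}`. -/
theorem lp_distance_distortion_bound {X X' : Type*}
    [MetricSpace X] [CompactSpace X] [MeasurableSpace X] [BorelSpace X]
    [MetricSpace X'] [CompactSpace X'] [MeasurableSpace X'] [BorelSpace X']
    (μ : Measure X) [IsProbabilityMeasure μ] (μ' : Measure X') [IsProbabilityMeasure μ']
    (p : ℝ) (hp : 1 ≤ p)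
    (δ : X ⊕ X' → X ⊕ X' → ℝ) (hδ : MetricCoupling μ μ' δ)
    (h : Measure (X × X')) [IsProbabilityMeasure h]
    (h1 : h.map Prod.fst = μ) (h2 : h.map Prod.snd = μ')
    (f g : X → ℝ) (f' g' : X' → ℝ)
    (hf : LipschitzWith 1 f) (hg : LipschitzWith 1 g)
    (hf' : LipschitzWith 1 f') (hg' : LipschitzWith 1 g')
    (hff' : SqcupLipschitz (msupport μ) (msupport μ') δ f f')
    (hgg' : SqcupLipschitz (msupport μ) (msupport μ') δ g g') :
    |(∫ x, |f x - g x| ^ p ∂μ) ^ (1 / p) - (∫ x, |f' x - g' x| ^ p ∂μ') ^ (1 / p)| ≤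
      2 * (∫ q : X × X', δ (Sum.inl q.1) (Sum.inr q.2) ^ p ∂h) ^ (1 / p) := by
  subst h1 h2
  have hp0 : 0 < p := by linarith
  have hr : 1 ≤ ENNReal.ofReal p := by simpa using ENNReal.ofReal_le_ofReal hp
  have hr0 : ENNReal.ofReal p ≠ 0 := by simpa using hp0
  have hcf : Continuous fun q : X × X' ↦ f q.1 - g q.1 :=
    (hf.continuous.sub hg.continuous).comp continuous_fst
  have hcf' : Continuous fun q : X × X' ↦ f' q.2 - g' q.2 :=
    (hf'.continuous.sub hg'.continuous).comp continuous_snd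
  have hmem {u : X × X' → ℝ} (hu : Continuous u) : MemLp u (ENNReal.ofReal p) h := by
    obtain ⟨C, hC⟩ := isCompact_univ.exists_bound_of_continuousOn hu.continuousOn
    exact .of_bound hu.aestronglyMeasurable C (.of_forall fun x ↦ hC x trivial)
  have hnorm {u : X × X' → ℝ} (hu : MemLp u (ENNReal.ofReal p) h) :
      lpNorm u (ENNReal.ofReal p) h = (∫ q, |u q| ^ p ∂h) ^ (1 / p) := by
    simp [lpNorm_eq_integral_norm_rpow_toReal hr0 ENNReal.ofReal_ne_top hu.1, hp0.le]
  have hmain := abs_lpNorm_sub_lpNorm_le_two_mul hr (hmem hcf) (hmem hcf')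
    (hδ.memLp _) <| (ae_mem_msupport_prod h).mono fun q hq ↦ by
      have h₁ := hff' (.inl q.1) (.inl ⟨_, hq.1, rfl⟩) (.inr q.2) (.inr ⟨_, hq.2, rfl⟩)
      have h₂ := hgg' (.inl q.1) (.inl ⟨_, hq.1, rfl⟩) (.inr q.2) (.inr ⟨_, hq.2, rfl⟩)
      simp only [Sum.elim_inl, Sum.elim_inr] at h₁ h₂
      rw [abs_le] at h₁ h₂ ⊢
      constructor <;> linarith
  rw [hnorm (hmem hcf), hnorm (hmem hcf'), hnorm (hδ.memLp _)] at hmain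
  simp only [abs_of_nonneg (hδ.nonneg _ _)] at hmain
  rwa [integral_map measurable_fst.aemeasurable, integral_map measurable_snd.aemeasurable]
  · exact ((hf'.continuous.sub hg'.continuous).abs.rpow_const
      fun _ ↦ .inr hp0.le).aestronglyMeasurable
  · exact ((hf.continuous.sub hg.continuous).abs.rpow_const
      fun _ ↦ .inr hp0.le).aestronglyMeasurable
end

section
/- Let (X,d) be a compact metric space, μ a Borel probability measure on X, and φ₁, …, φ_{n−1} : X → ℝ a finite (possibly empty) family of μ-centered metric observables. Let V = {f ∈ Obs_c(μ) : ∫_X f φ_i dμ = 0 for all 1 ≤ i ≤ n−1}. Then the variance function f ↦ ∫_X f² dμ attains its maximum on V: there exists φ ∈ V with ∫_X φ² dμ ≥ ∫_X f² dμ for all f ∈ V. In particular, if V contains an observable of nonzero variance, an n-th principal observable exists. -/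
open MeasureTheory

open scoped BoundedContinuousFunction

/-- A centered `1`-Lipschitz function on a compact space is bounded by the diameter. -/
theorem abs_le_diam_of_integral_eq_zero {X : Type*} [MetricSpace X] [CompactSpace X]
    [MeasurableSpace X] [BorelSpace X] (μ : Measure X) [IsProbabilityMeasure μ]
    {f : X → ℝ} (hf : LipschitzWith 1 f) (hfc : ∫ x, f x ∂μ = 0) (x : X) :
    |f x| ≤ Metric.diam (Set.univ : Set X) := by
  have hint : Integrable f μ :=
    hf.continuous.integrable_of_hasCompactSupport (HasCompactSupport.of_compactSpace f)
  have hx : f x = ∫ y, (f x - f y) ∂μ := by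
    rw [integral_sub (integrable_const _) hint, hfc]
    simp
  rw [hx, ← Real.norm_eq_abs]
  refine (norm_integral_le_of_norm_le_const (C := Metric.diam (Set.univ : Set X))
    (.of_forall fun y ↦ ?_)).trans (by simp)
  calc ‖f x - f y‖ = dist (f x) (f y) := (dist_eq_norm _ _).symm
    _ ≤ dist x y := by simpa using hf.dist_le_mul x y
    _ ≤ Metric.diam Set.univ :=
      Metric.dist_le_diam_of_mem isCompact_univ.isBounded (Set.mem_univ x) (Set.mem_univ y)

/-- Integrals over a compact space depend continuously on a parameter. -/
theorem continuous_integral_of_continuous_uncurry {X Y : Type*} [TopologicalSpace X]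
    [CompactSpace X] [MeasurableSpace X] [OpensMeasurableSpace X] [TopologicalSpace Y]
    (μ : Measure X) [IsFiniteMeasure μ] {F : Y → X → ℝ}
    (hF : Continuous (Function.uncurry F)) : Continuous fun y ↦ ∫ x, F y x ∂μ := by
  rw [← continuousOn_univ]
  exact continuousOn_integral_of_compact_support isCompact_univ hF.continuousOn (by simp)

/-- Existence of principal observables. Given finitely many μ-centered
metric observables `φ₁, …, φ_{n-1}`, the variance `f ↦ ∫ f² dμ` attains its maximum
on the set `V` of μ-centered metric observables that are μ-orthogonal to all `φ_i`. -/
theorem principal_observable_exists {X : Type*} [MetricSpace X] [CompactSpace X]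
    [MeasurableSpace X] [BorelSpace X]
    (μ : Measure X) [IsProbabilityMeasure μ]
    (m : ℕ) (φ : Fin m → X → ℝ)
    (hφ : ∀ i, LipschitzWith 1 (φ i)) (hφc : ∀ i, ∫ x, φ i x ∂μ = 0) :
    ∃ g : X → ℝ, (LipschitzWith 1 g ∧ ∫ x, g x ∂μ = 0 ∧ ∀ i, ∫ x, g x * φ i x ∂μ = 0) ∧
      ∀ f : X → ℝ, LipschitzWith 1 f → ∫ x, f x ∂μ = 0 →
        (∀ i, ∫ x, f x * φ i x ∂μ = 0) →
        ∫ x, f x ^ 2 ∂μ ≤ ∫ x, g x ^ 2 ∂μ := by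
  let A : Set (X →ᵇ ℝ) :=
    {f | LipschitzWith 1 f ∧ ∫ x, f x ∂μ = 0 ∧ ∀ i, ∫ x, f x * φ i x ∂μ = 0}
  have heval : Continuous fun p : (X →ᵇ ℝ) × X ↦ p.1 p.2 := continuous_eval
  have hclosed : IsClosed A := by
    have hlip : IsClosed {f : X →ᵇ ℝ | LipschitzWith 1 f} := by
      have hcoe : Continuous fun f : X →ᵇ ℝ ↦ (f : X → ℝ) :=
        BoundedContinuousFunction.continuous_coe
      exact (isClosed_setOfPred_lipschitzWith (α := X) (β := ℝ) 1).preimage hcoe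
    have hcentered : IsClosed {f : X →ᵇ ℝ | ∫ x, f x ∂μ = 0} :=
      isClosed_eq (continuous_integral_of_continuous_uncurry μ heval) continuous_const
    have horth : IsClosed {f : X →ᵇ ℝ | ∀ i, ∫ x, f x * φ i x ∂μ = 0} := by
      rw [Set.ofPred_forall]
      refine isClosed_iInter fun i ↦ isClosed_eq
        (continuous_integral_of_continuous_uncurry μ ?_) continuous_const
      exact heval.mul ((hφ i).continuous.comp continuous_snd)
    exact hlip.inter (hcentered.inter horth)
  have hcompact : IsCompact A := by
    refine BoundedContinuousFunction.arzela_ascoli₂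
      (Metric.closedBall 0 (Metric.diam (Set.univ : Set X))) (isCompact_closedBall _ _) A hclosed
      (fun f x hf ↦ ?_)
      (LipschitzWith.uniformEquicontinuous _ 1 fun f ↦ f.2.1).equicontinuous
    simpa using abs_le_diam_of_integral_eq_zero μ hf.1 hf.2.1 x
  have hvar : Continuous fun f : X →ᵇ ℝ ↦ ∫ x, f x ^ 2 ∂μ :=
    continuous_integral_of_continuous_uncurry μ (heval.pow 2)
  have hne : A.Nonempty := ⟨0, by
    refine ⟨?_, by simp, by simp⟩
    exact LipschitzWith.const' 0⟩
  obtain ⟨g, hg, hmax⟩ := hcompact.exists_isMaxOn hne hvar.continuousOn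
  refine ⟨g, hg, fun f hf hfc hfφ ↦ ?_⟩
  exact hmax (show BoundedContinuousFunction.mkOfCompact ⟨f, hf.continuous⟩ ∈ A from
    ⟨hf, hfc, hfφ⟩)
end
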